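/- Let (X,d) be a metric space, x₀ ∈ X, and let Λ be a set of geodesic rays in X based at x₀ such that for any two distinct r,r' ∈ Λ the function t ↦ d(r(t),r'(t)) is convex on [0,∞). Fix A > 0 and let d_A be the metric on Λ given by d_A(r,r') := 1/t_A(r,r') for r ≠ r' (where t_A(r,r') is the unique t > 0 with d(r(t),r'(t)) = A) and d_A(r,r) := 0. Then the family of geodesic rays (r)_{r∈Λ} is conical with respect to d_A for the constant C = A. -/

import Mathlib

open scoped Classical

/-- A convex function on `[0, ∞)` vanishing at `0` has nondecreasing slope from the origin. -/
theorem ConvexOn.mul_le_mul_of_map_zero {f : ℝ → ℝ} (hf : ConvexOn ℝ (Set.Ici 0) f)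
    (h0 : f 0 = 0) {s t : ℝ} (hs : 0 ≤ s) (hst : s ≤ t) : f s * t ≤ s * f t := by
  rcases (hs.trans hst).eq_or_lt with ht | ht
  · obtain rfl : s = 0 := le_antisymm (hst.trans ht.ge) hs
    simp [h0]
  · have h := hf.2 (Set.mem_Ici.2 le_rfl) (Set.mem_Ici.2 ht.le)
      (sub_nonneg.2 ((div_le_one ht).2 hst)) (div_nonneg hs ht.le) (sub_add_cancel 1 (s / t))
    simp only [smul_eq_mul, mul_zero, zero_add, h0, div_mul_cancel₀ s ht.ne'] at h
    calc f s * t ≤ s / t * f t * t := mul_le_mul_of_nonneg_right h ht.le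
      _ = s * f t := by field_simp

/-- With `Λ` (the set `S`) a set of geodesic rays based at `x₀` with pairwise convex
distance functions, `A > 0`, and `d_A` the associated metric, the family of rays is
conical with respect to `d_A` for the constant `C = A`:
(1) for every `N > 0` there is `ε > 0` such that for all `0 ≤ t ≤ N`, if
`d_A(r,r') ≤ ε` then `dist (r t) (r' t) ≤ A`;
(2) for every `L ≥ A` and `ε' > 0` there is `N' > 0` such that for all `t ≥ N'`, if
`dist (r t) (r' t) ≤ L` then `d_A(r,r') ≤ ε'`. -/
theorem rays_conical_wrt_dA {X : Type*} [MetricSpace X] (x₀ : X) (S : Set (ℝ → X))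
    (hray : ∀ r ∈ S, r 0 = x₀ ∧ ∀ s t : ℝ, 0 ≤ s → 0 ≤ t → dist (r s) (r t) = |s - t|)
    (hconv : ∀ r ∈ S, ∀ r' ∈ S, r ≠ r' →
      ConvexOn ℝ (Set.Ici 0) (fun t => dist (r t) (r' t)))
    (A : ℝ) (hA : 0 < A)
    (tA : (ℝ → X) → (ℝ → X) → ℝ)
    (htA : ∀ r ∈ S, ∀ r' ∈ S, r ≠ r' →
      0 < tA r r' ∧ dist (r (tA r r')) (r' (tA r r')) = A) :
    let dA : (ℝ → X) → (ℝ → X) → ℝ := fun r r' => if r = r' then 0 else (tA r r')⁻¹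
    (∀ N > (0 : ℝ), ∃ ε > (0 : ℝ), ∀ t : ℝ, 0 ≤ t → t ≤ N →
      ∀ r ∈ S, ∀ r' ∈ S, dA r r' ≤ ε → dist (r t) (r' t) ≤ A) ∧
    (∀ L : ℝ, A ≤ L → ∀ ε' > (0 : ℝ), ∃ N' > (0 : ℝ), ∀ t : ℝ, N' ≤ t →
      ∀ r ∈ S, ∀ r' ∈ S, dist (r t) (r' t) ≤ L → dA r r' ≤ ε') := by
  intro dA
  have hslope : ∀ r ∈ S, ∀ r' ∈ S, r ≠ r' → ∀ s t : ℝ, 0 ≤ s → s ≤ t →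
      dist (r s) (r' s) * t ≤ s * dist (r t) (r' t) := fun r hr r' hr' hne s t hs hst =>
    (hconv r hr r' hr' hne).mul_le_mul_of_map_zero
      (by simp [(hray r hr).1, (hray r' hr').1]) hs hst
  refine ⟨fun N hN => ⟨N⁻¹, inv_pos.2 hN, fun t ht htN r hr r' hr' hd => ?_⟩,
    fun L hL ε hε => ⟨L / (A * ε), div_pos (hA.trans_le hL) (mul_pos hA hε),
      fun t ht r hr r' hr' hd => ?_⟩⟩
  · by_cases hne : r = r'
    · simpa [hne] using hA.le
    obtain ⟨hT, hTA⟩ := htA r hr r' hr' hne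
    simp only [dA, if_neg hne] at hd
    have htT : t ≤ tA r r' := htN.trans ((inv_le_inv₀ hT hN).1 hd)
    have h := hslope r hr r' hr' hne t _ ht htT
    rw [hTA] at h
    refine le_of_mul_le_mul_right (h.trans ?_) hT
    rw [mul_comm A]
    exact mul_le_mul_of_nonneg_right htT hA.le
  · by_cases hne : r = r'
    · simpa [dA, hne] using hε.le
    obtain ⟨hT, hTA⟩ := htA r hr r' hr' hne
    simp only [dA, if_neg hne]
    have hL0 : 0 < L := hA.trans_le hL
    have ht0 : 0 < t := (div_pos hL0 (mul_pos hA hε)).trans_le ht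
    have hkey : A * t ≤ tA r r' * L := by
      rcases le_total (tA r r') t with htT | htT
      · have h := hslope r hr r' hr' hne _ t hT.le htT
        rw [hTA] at h
        exact h.trans (mul_le_mul_of_nonneg_left hd hT.le)
      · rw [mul_comm]
        exact mul_le_mul htT hL hA.le hT.le
    rw [div_le_iff₀ (mul_pos hA hε)] at ht
    rw [inv_le_iff_one_le_mul₀ hT]
    refine le_of_mul_le_mul_right ?_ hL0
    calc 1 * L ≤ ε * (A * t) := by linarith
      _ ≤ ε * (tA r r' * L) := mul_le_mul_of_nonneg_left hkey hε.le
      _ = ε * tA r r' * L := by ring
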